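/- Theta transformation formula in the right half-plane with characteristic (slice form of Theorem 4.12): let d ≥ 1, let A be an invertible real d×d matrix, let s ∈ ℂ with Re s > 0 and let w ∈ ℂ^d. Then ∑_{m∈ℤ^d} exp(−π·s·∑_{j=1}^d ((Am)_j + w_j)²) = s^{−d/2} · |det A|⁻¹ · ∑_{k∈ℤ^d} exp(−π‖(Aᵀ)⁻¹k‖²·s⁻¹ + 2πi·∑_{j=1}^d ((Aᵀ)⁻¹k)_j·w_j). -/

import Mathlib

open Matrix
open MeasureTheory Set TopologicalSpace UnitAddTorus

section PoissonSummation

variable {ι : Type*} [Fintype ι]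

theorem UnitAddTorus.mFourier_coe_apply (k : ι → ℤ) (x : ι → ℝ) :
    mFourier k (fun i ↦ (x i : UnitAddCircle)) =
      Complex.exp (2 * Real.pi * Complex.I * ∑ i, (k i : ℂ) * x i) := by
  simp only [mFourier, ContinuousMap.coe_mk, fourier_coe_apply, Finset.mul_sum, Complex.exp_sum]
  refine Finset.prod_congr rfl fun i _ ↦ ?_
  congr 1
  push_cast
  ring

theorem hasSum_setIntegral_unitCube_comp_add_int {E : Type*} [NormedAddCommGroup E]
    [NormedSpace ℝ E] {g : (ι → ℝ) → E} (hg : Integrable g) :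
    HasSum (fun n : ι → ℤ ↦ ∫ x in {x : ι → ℝ | ∀ i, x i ∈ Ioc (0 : ℝ) (0 + 1)},
      g (x + fun i ↦ (n i : ℝ))) (∫ x, g x) := by
  let s : (ι → ℤ) → Set (ι → ℝ) := fun n ↦ {x | ∀ i, x i ∈ Ioc (n i : ℝ) (n i + 1)}
  have mem_s (n : ι → ℤ) (x : ι → ℝ) : x ∈ s n ↔ ∀ i, ⌈x i⌉ = n i + 1 := by
    simp [s, Int.ceil_eq_iff]
  have s_meas (n : ι → ℤ) : MeasurableSet (s n) :=
    MeasurableSet.univ_pi' fun i ↦ measurableSet_Ioc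
  have s_disj : Pairwise (Function.onFun Disjoint s) := by
    refine fun m n hmn ↦ Set.disjoint_left.mpr fun x hm hn ↦ hmn <| funext fun i ↦ ?_
    have h₁ := (mem_s m x).mp hm i
    have h₂ := (mem_s n x).mp hn i
    omega
  have s_univ : ⋃ n, s n = univ :=
    eq_univ_of_forall fun x ↦ mem_iUnion.mpr ⟨fun i ↦ ⌈x i⌉ - 1, (mem_s _ x).mpr (by simp)⟩
  have key := hasSum_integral_iUnion (μ := volume) s_meas s_disj hg.integrableOn
  rw [s_univ, setIntegral_univ] at key
  convert key using 2 with n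
  rw [← (measurePreserving_add_right volume fun i ↦ (n i : ℝ)).setIntegral_preimage_emb
    (measurableEmbedding_addRight _) g (s n)]
  congr 2
  ext x
  simp [s, add_comm (x _)]

omit [Fintype ι] in
theorem isOpenQuotientMap_coe_unitAddTorus :
    IsOpenQuotientMap fun (x : ι → ℝ) i ↦ (x i : UnitAddCircle) :=
  IsOpenQuotientMap.piMap fun _ ↦ QuotientAddGroup.isOpenQuotientMap_mk

variable {f : C(ι → ℝ, ℂ)}

/-- **Poisson summation formula** for continuous functions on `ι → ℝ`, with respect to the
standard lattice. -/
theorem tsum_eq_tsum_integral_mFourier (hf : Integrable f)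
    (h_norm : ∀ K : Compacts (ι → ℝ), Summable fun n : ι → ℤ ↦
      ‖(f.comp (ContinuousMap.addRight fun i ↦ (n i : ℝ))).restrict K‖)
    (h_sum : Summable fun k : ι → ℤ ↦
      ∫ x, mFourier (-k) (fun i ↦ (x i : UnitAddCircle)) * f x) :
    ∑' n : ι → ℤ, f (fun i ↦ (n i : ℝ)) =
      ∑' k : ι → ℤ, ∫ x, mFourier (-k) (fun i ↦ (x i : UnitAddCircle)) * f x := by
  let π : C(ι → ℝ, UnitAddTorus ι) :=
    ⟨fun x i ↦ (x i : UnitAddCircle), isOpenQuotientMap_coe_unitAddTorus.continuous⟩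
  have hπ : Topology.IsQuotientMap π := isOpenQuotientMap_coe_unitAddTorus.isQuotientMap
  have π_add (x : ι → ℝ) (n : ι → ℤ) : π (x + fun i ↦ (n i : ℝ)) = π x := by
    ext i
    change ((x i + n i : ℝ) : UnitAddCircle) = (x i : UnitAddCircle)
    rw [AddCircle.coe_add, (AddCircle.coe_eq_zero_iff (1 : ℝ) (x := n i)).mpr ⟨n i, by simp⟩,
      add_zero]
  have summ := ContinuousMap.summable_of_locally_summable_norm h_norm
  let G : C(ι → ℝ, ℂ) := ∑' n : ι → ℤ, f.comp (ContinuousMap.addRight fun i ↦ (n i : ℝ))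
  have G_apply (x : ι → ℝ) : G x = ∑' n : ι → ℤ, f (x + fun i ↦ (n i : ℝ)) := by
    simp [G, ← ContinuousMap.tsum_apply summ]
  have G_periodic (x : ι → ℝ) (m : ι → ℤ) : G (x + fun i ↦ (m i : ℝ)) = G x := by
    rw [G_apply, G_apply, ← (Equiv.addLeft m).tsum_eq fun n ↦ f (x + fun i ↦ (n i : ℝ))]
    refine tsum_congr fun n ↦ congrArg f ?_
    ext i
    simp [add_assoc]
  have G_factors : Function.FactorsThrough G π := by
    intro x y hxy
    have (i : ι) : ∃ n : ℤ, (n : ℝ) = x i - y i := by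
      have := congrFun hxy i
      simpa using (AddCircle.coe_eq_zero_iff (1 : ℝ) (x := x i - y i)).mp
        (by rw [AddCircle.coe_sub, sub_eq_zero]; exact this)
    choose n hn using this
    rw [← G_periodic y n]
    congr 1
    ext i
    simp [hn]
  let F : C(UnitAddTorus ι, ℂ) := hπ.lift G G_factors
  have F_apply (x : ι → ℝ) : F (π x) = G x :=
    congrArg (fun h : C(ι → ℝ, ℂ) ↦ h x) (hπ.lift_comp G G_factors)
  have coeff (k : ι → ℤ) : mFourierCoeff F k = ∫ x, mFourier (-k) (π x) * f x := by
    have norm_e (x : UnitAddTorus ι) : ‖mFourier (-k) x‖ = 1 := by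
      simp only [mFourier, fourier_apply, ContinuousMap.coe_mk, norm_prod, Circle.norm_coe,
        Finset.prod_const_one]
    have g_int : Integrable fun x ↦ mFourier (-k) (π x) * f x := by
      refine hf.bdd_mul (c := 1) (by fun_prop) (.of_forall fun x ↦ (norm_e _).le)
    rw [mFourierCoeff_eq_integral F k 0,
      ← (hasSum_setIntegral_unitCube_comp_add_int g_int).tsum_eq]
    have swap := hasSum_integral_of_summable_integral_norm
      (μ := volume.restrict {x : ι → ℝ | ∀ i, x i ∈ Ioc (0 : ℝ) (0 + 1)})
      (F := fun (n : ι → ℤ) x ↦ mFourier (-k) (π (x + fun i ↦ (n i : ℝ))) *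
        f (x + fun i ↦ (n i : ℝ)))
      (fun n ↦ (g_int.comp_add_right fun i ↦ (n i : ℝ)).integrableOn)
      (hasSum_setIntegral_unitCube_comp_add_int g_int.norm).summable
    rw [swap.tsum_eq]
    refine integral_congr_ae (.of_forall fun x ↦ ?_)
    simp only [π_add, tsum_mul_left, ← G_apply, ← F_apply]
    rfl
  have := hasSum_mFourier_series_apply_of_summable (f := F)
    (h_sum.congr fun k ↦ (coeff k).symm) (π 0)
  rw [F_apply, G_apply] at this
  simp only [zero_add] at this
  rw [← this.tsum_eq]
  refine tsum_congr fun k ↦ ?_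
  rw [coeff]
  have : mFourier k (π 0) = 1 := (mFourier_coe_apply k 0).trans (by simp)
  rw [this, smul_eq_mul, mul_one]
  rfl

end PoissonSummation

section Gaussian

variable {ι : Type*} [Fintype ι]

theorem Summable.pi_prod {κ : Type*} {u : κ → ℝ} (hu₀ : ∀ n, 0 ≤ u n) (hu : Summable u) :
    Summable fun n : ι → κ ↦ ∏ i, u (n i) := by
  classical
  refine summable_of_sum_le (c := ∏ _i : ι, ∑' n, u n)
    (fun n ↦ Finset.prod_nonneg fun i _ ↦ hu₀ _) fun S ↦ ?_
  have hS : S ⊆ Fintype.piFinset fun i ↦ S.image (· i) := fun n hn ↦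
    Fintype.mem_piFinset.mpr fun i ↦ Finset.mem_image_of_mem _ hn
  refine (Finset.sum_le_sum_of_subset_of_nonneg hS
    fun n _ _ ↦ Finset.prod_nonneg fun i _ ↦ hu₀ _).trans ?_
  rw [← Finset.prod_univ_sum]
  exact Finset.prod_le_prod (fun i _ ↦ Finset.sum_nonneg fun _ _ ↦ hu₀ _)
    fun i _ ↦ hu.sum_le_tsum _ fun _ _ ↦ hu₀ _

theorem summable_prod_exp_neg_mul_int_sq {c : ℝ} (hc : 0 < c) :
    Summable fun n : ι → ℤ ↦ ∏ i, Real.exp (-c * (n i : ℝ) ^ 2) := by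
  refine Summable.pi_prod (u := fun n : ℤ ↦ Real.exp (-c * (n : ℝ) ^ 2))
    (fun n ↦ (Real.exp_pos _).le) ?_
  refine (summable_pow_mul_jacobiTheta₂_term_bound 0 (div_pos hc Real.pi_pos) 0).congr fun n ↦ ?_
  rw [pow_zero, one_mul]
  congr 1
  field_simp
  ring

theorem summable_norm_restrict_comp_addRight_of_gaussian_bound {f : C(ι → ℝ, ℂ)} {C c : ℝ}
    (hC : 0 ≤ C) (hc : 0 < c) (hf : ∀ x, ‖f x‖ ≤ C * ∏ i, Real.exp (-c * x i ^ 2))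
    (K : Compacts (ι → ℝ)) :
    Summable fun n : ι → ℤ ↦
      ‖(f.comp (ContinuousMap.addRight fun i ↦ (n i : ℝ))).restrict K‖ := by
  obtain ⟨R, hR⟩ := K.isCompact.isBounded.exists_norm_le
  refine .of_nonneg_of_le (fun _ ↦ norm_nonneg _) (fun n ↦ ?_)
    ((summable_prod_exp_neg_mul_int_sq (ι := ι) (half_pos hc)).mul_left
      (C * ∏ _i : ι, Real.exp (c * R ^ 2)))
  refine (ContinuousMap.norm_le _ (by positivity)).mpr fun x ↦ ?_
  refine (hf _).trans ?_
  rw [mul_assoc, ← Finset.prod_mul_distrib]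
  refine mul_le_mul_of_nonneg_left (Finset.prod_le_prod (fun _ _ ↦ (Real.exp_pos _).le)
    fun i _ ↦ ?_) hC
  rw [← Real.exp_add]
  refine Real.exp_le_exp.mpr ?_
  have hx : x.1 i ^ 2 ≤ R ^ 2 :=
    sq_le_sq' (abs_le.mp ((norm_le_pi_norm x.1 i).trans (hR x x.2))).1
      (abs_le.mp ((norm_le_pi_norm x.1 i).trans (hR x x.2))).2
  change -c * (x.1 i + n i) ^ 2 ≤ _
  nlinarith [mul_nonneg hc.le (sq_nonneg (2 * x.1 i + n i)), mul_le_mul_of_nonneg_left hx hc.le]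

variable [DecidableEq ι]

theorem exists_sum_sq_le_mul_sum_mulVec_sq {M : Matrix ι ι ℝ} (hM : IsUnit M.det) :
    ∃ κ : ℝ, 0 < κ ∧ ∀ x : ι → ℝ, ∑ i, x i ^ 2 ≤ κ * ∑ j, (M *ᵥ x) j ^ 2 := by
  refine ⟨∑ i, ∑ j, M⁻¹ i j ^ 2 + 1, by positivity, fun x ↦ ?_⟩
  have hx : M⁻¹ *ᵥ (M *ᵥ x) = x := by rw [mulVec_mulVec, nonsing_inv_mul M hM, one_mulVec]
  calc ∑ i, x i ^ 2 = ∑ i, (∑ j, M⁻¹ i j * (M *ᵥ x) j) ^ 2 :=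
        Finset.sum_congr rfl fun i _ ↦ congrArg (· ^ 2) (congrFun hx i).symm
    _ ≤ ∑ i, (∑ j, M⁻¹ i j ^ 2) * ∑ j, (M *ᵥ x) j ^ 2 :=
        Finset.sum_le_sum fun i _ ↦ Finset.sum_mul_sq_le_sq_mul_sq _ _ _
    _ ≤ (∑ i, ∑ j, M⁻¹ i j ^ 2 + 1) * ∑ j, (M *ᵥ x) j ^ 2 := by
        rw [← Finset.sum_mul, add_mul, one_mul]
        exact le_add_of_nonneg_right (by positivity)

theorem exists_norm_cexp_quadratic_mulVec_le {M : Matrix ι ι ℝ} (hM : IsUnit M.det) {b : ℂ}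
    (hb : 0 < b.re) (v : ι → ℂ) :
    ∃ C c : ℝ, 0 ≤ C ∧ 0 < c ∧ ∀ x : ι → ℝ,
      ‖Complex.exp (-b * ∑ j, ((M *ᵥ x) j : ℂ) ^ 2 + ∑ j, v j * (M *ᵥ x) j)‖ ≤
        C * ∏ i, Real.exp (-c * x i ^ 2) := by
  obtain ⟨κ, hκ, hM'⟩ := exists_sum_sq_le_mul_sum_mulVec_sq hM
  refine ⟨Real.exp (∑ j, (v j).re ^ 2 / (2 * b.re)), b.re / (2 * κ), (Real.exp_pos _).le,
    by positivity, fun x ↦ ?_⟩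
  rw [Complex.norm_exp, ← Real.exp_sum, ← Real.exp_add, Real.exp_le_exp, ← Finset.mul_sum]
  have h_re : (-b * ∑ j, ((M *ᵥ x) j : ℂ) ^ 2 + ∑ j, v j * (M *ᵥ x) j).re =
      ∑ j, (-b.re * (M *ᵥ x) j ^ 2 + (v j).re * (M *ᵥ x) j) := by
    rw [Finset.mul_sum, ← Finset.sum_add_distrib, Complex.re_sum]
    refine Finset.sum_congr rfl fun j _ ↦ ?_
    rw [← Complex.ofReal_pow, Complex.add_re, Complex.re_mul_ofReal, Complex.re_mul_ofReal,
      Complex.neg_re]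
  have h_le (j : ι) : -b.re * (M *ᵥ x) j ^ 2 + (v j).re * (M *ᵥ x) j ≤
      (v j).re ^ 2 / (2 * b.re) + -(b.re / 2) * (M *ᵥ x) j ^ 2 := by
    have : (v j).re ^ 2 / (2 * b.re) + -(b.re / 2) * (M *ᵥ x) j ^ 2 -
        (-b.re * (M *ᵥ x) j ^ 2 + (v j).re * (M *ᵥ x) j) =
        ((v j).re - b.re * (M *ᵥ x) j) ^ 2 / (2 * b.re) := by
      field_simp
      ring
    rw [← sub_nonneg, this]
    positivity
  rw [h_re]
  refine (Finset.sum_le_sum fun j _ ↦ h_le j).trans ?_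
  rw [Finset.sum_add_distrib, ← Finset.mul_sum]
  refine add_le_add le_rfl ?_
  have := mul_le_mul_of_nonneg_left (hM' x) (show 0 ≤ b.re / (2 * κ) by positivity)
  have h_eq : b.re / (2 * κ) * (κ * ∑ j, (M *ᵥ x) j ^ 2) = b.re / 2 * ∑ j, (M *ᵥ x) j ^ 2 := by
    field_simp
  linarith

theorem integral_comp_mulVec {E : Type*} [NormedAddCommGroup E] [NormedSpace ℝ E]
    {M : Matrix ι ι ℝ} (hM : M.det ≠ 0) {g : (ι → ℝ) → E} (hg : Continuous g) :
    ∫ x, g (M *ᵥ x) = |M.det|⁻¹ • ∫ y, g y := by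
  have h_meas : Measurable (toLin' M) := (toLin' M).continuous_of_finiteDimensional.measurable
  have := integral_map (μ := volume) h_meas.aemeasurable
    (hg.aestronglyMeasurable (μ := Measure.map (toLin' M) volume))
  rw [Real.map_matrix_volume_pi_eq_smul_volume_pi hM, integral_smul_measure] at this
  simpa [abs_inv] using this.symm

theorem MeasureTheory.Integrable.comp_mulVec {E : Type*} [NormedAddCommGroup E]
    {M : Matrix ι ι ℝ} (hM : M.det ≠ 0) {g : (ι → ℝ) → E} (hg : Integrable g) :
    Integrable fun x ↦ g (M *ᵥ x) := by
  have h_meas : Measurable (toLin' M) := (toLin' M).continuous_of_finiteDimensional.measurable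
  refine Integrable.comp_measurable (f := toLin' M) ?_ h_meas
  rw [Real.map_matrix_volume_pi_eq_smul_volume_pi hM]
  exact hg.smul_measure ENNReal.ofReal_ne_top

theorem sum_mul_eq_sum_inv_transpose_mulVec_mul_mulVec {M : Matrix ι ι ℝ} (hM : IsUnit M.det)
    (k x : ι → ℝ) : ∑ i, k i * x i = ∑ j, (Mᵀ⁻¹ *ᵥ k) j * (M *ᵥ x) j := by
  change k ⬝ᵥ x = (Mᵀ⁻¹ *ᵥ k) ⬝ᵥ (M *ᵥ x)
  rw [dotProduct_mulVec, ← mulVec_transpose, mulVec_mulVec,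
    mul_nonsing_inv _ (by rwa [det_transpose]), one_mulVec]

omit [DecidableEq ι] in
theorem integral_cexp_neg_pi_mul_sum_sq_add {s : ℂ} (hs : 0 < s.re) (w : ι → ℂ) (p : ι → ℝ) :
    ∫ y : ι → ℝ, Complex.exp (-(2 * Real.pi * Complex.I * ∑ j, (p j : ℂ) * y j)) *
        Complex.exp (-Real.pi * s * ∑ j, ((y j : ℂ) + w j) ^ 2) =
      s ^ (-(Fintype.card ι : ℂ) / 2) *
        Complex.exp (-Real.pi * (∑ j, p j ^ 2 : ℝ) * s⁻¹ +
          2 * Real.pi * Complex.I * ∑ j, (p j : ℂ) * w j) := by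
  have hs₀ : s ≠ 0 := by rintro rfl; simp at hs
  have hπ : (Real.pi : ℂ) ≠ 0 := mod_cast Real.pi_ne_zero
  have hb : 0 < ((Real.pi : ℂ) * s).re := by
    rw [Complex.re_ofReal_mul]
    exact mul_pos Real.pi_pos hs
  have h_integrand (y : ι → ℝ) :
      Complex.exp (-(2 * Real.pi * Complex.I * ∑ j, (p j : ℂ) * y j)) *
        Complex.exp (-Real.pi * s * ∑ j, ((y j : ℂ) + w j) ^ 2) =
      Complex.exp (-Real.pi * s * ∑ j, w j ^ 2) *
        Complex.exp (-(Real.pi * s) * ∑ j, (y j : ℂ) ^ 2 +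
          ∑ j, (-2 * Real.pi * (s * w j + Complex.I * p j)) * y j) := by
    rw [← Complex.exp_add, ← Complex.exp_add]
    congr 1
    simp only [Finset.mul_sum, ← Finset.sum_add_distrib, ← Finset.sum_neg_distrib]
    refine Finset.sum_congr rfl fun j _ ↦ ?_
    ring
  have h_pow : ((Real.pi : ℂ) / (Real.pi * s)) ^ ((Fintype.card ι : ℂ) / 2) =
      s ^ (-(Fintype.card ι : ℂ) / 2) := by
    have h_arg : s.arg ≠ Real.pi := by
      intro h
      exact absurd (Complex.arg_eq_pi_iff.mp h).1 hs.le.not_gt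
    rw [div_mul_cancel_left₀ hπ, Complex.inv_cpow _ _ h_arg, neg_div, Complex.cpow_neg]
  simp_rw [h_integrand]
  rw [integral_const_mul, GaussianFourier.integral_cexp_neg_mul_sum_add hb, h_pow, mul_left_comm,
    ← Complex.exp_add]
  congr 2
  push_cast
  simp only [Finset.mul_sum, Finset.sum_mul, Finset.sum_div, ← Finset.sum_add_distrib]
  refine Finset.sum_congr rfl fun j _ ↦ ?_
  field_simp
  ring_nf
  simp only [Complex.I_sq]
  ring

end Gaussian

/-- **Theta transformation formula in the right half-plane with characteristic** (slice
form of Theorem 4.12): for `d ≥ 1`, `A` an invertible real `d × d` matrix, `s ∈ ℂ` with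
`Re s > 0` and `w ∈ ℂ^d`,
`∑_{m∈ℤ^d} exp(−πs ∑ⱼ((Am)ⱼ+wⱼ)²)
  = s^{−d/2} |det A|⁻¹ ∑_{k∈ℤ^d} exp(−π‖(Aᵀ)⁻¹k‖² s⁻¹ + 2πi ∑ⱼ((Aᵀ)⁻¹k)ⱼwⱼ)`. -/
theorem theta_transformation_right_half_plane (d : ℕ) (hd : 1 ≤ d)
    (A : Matrix (Fin d) (Fin d) ℝ) (hA : IsUnit A.det)
    (s : ℂ) (hs : 0 < s.re) (w : Fin d → ℂ) :
    ∑' m : Fin d → ℤ,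
        Complex.exp (-(Real.pi : ℂ) * s *
          ∑ j, ((A.mulVec (fun i => (m i : ℝ)) j : ℂ) + w j) ^ 2)
      = s ^ (-(d : ℂ) / 2) * ((|A.det| : ℝ)⁻¹ : ℂ) *
        ∑' k : Fin d → ℤ,
          Complex.exp (-(Real.pi : ℂ) *
              ((∑ j, ((Aᵀ)⁻¹.mulVec (fun i => (k i : ℝ)) j) ^ 2 : ℝ) : ℂ) * s⁻¹
            + 2 * (Real.pi : ℂ) * Complex.I *
              ∑ j, ((Aᵀ)⁻¹.mulVec (fun i => (k i : ℝ)) j : ℂ) * w j) := by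
  have hπs : 0 < ((Real.pi : ℂ) * s).re := by
    rw [Complex.re_ofReal_mul]
    exact mul_pos Real.pi_pos hs
  have hπs' : 0 < ((Real.pi : ℂ) * s⁻¹).re := by
    rw [Complex.re_ofReal_mul, Complex.inv_re]
    exact mul_pos Real.pi_pos (div_pos hs (Complex.normSq_pos.mpr (by rintro rfl; simp at hs)))
  have hA' : IsUnit (Aᵀ)⁻¹.det := isUnit_nonsing_inv_det _ (by rwa [det_transpose])
  let f : C(Fin d → ℝ, ℂ) :=
    ⟨fun x ↦ Complex.exp (-Real.pi * s * ∑ j, (((A *ᵥ x) j : ℂ) + w j) ^ 2), by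
      simp only [mulVec, dotProduct]; fun_prop⟩
  have f_eq (x : Fin d → ℝ) : f x = Complex.exp (-Real.pi * s * ∑ j, w j ^ 2) *
      Complex.exp (-(Real.pi * s) * ∑ j, ((A *ᵥ x) j : ℂ) ^ 2 +
        ∑ j, (-2 * Real.pi * s * w j) * (A *ᵥ x) j) := by
    rw [← Complex.exp_add]
    refine congrArg Complex.exp ?_
    simp only [Finset.mul_sum, ← Finset.sum_add_distrib]
    exact Finset.sum_congr rfl fun j _ ↦ by ring
  have f_int : Integrable f := by
    exact (((GaussianFourier.integrable_cexp_neg_mul_sum_add hπs _).comp_mulVec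
      hA.ne_zero).const_mul _).congr (.of_forall fun x ↦ (f_eq x).symm)
  obtain ⟨C, c, hC, hc, hf⟩ := exists_norm_cexp_quadratic_mulVec_le hA hπs
    fun j ↦ -2 * Real.pi * s * w j
  have f_bound (x : Fin d → ℝ) : ‖f x‖ ≤ ‖Complex.exp (-Real.pi * s * ∑ j, w j ^ 2)‖ * C *
      ∏ i, Real.exp (-c * x i ^ 2) := by
    rw [f_eq, norm_mul]
    exact (mul_le_mul_of_nonneg_left (hf x) (norm_nonneg _)).trans_eq (mul_assoc _ _ _).symm
  have f_norm := summable_norm_restrict_comp_addRight_of_gaussian_bound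
    (mul_nonneg (norm_nonneg _) hC) hc f_bound
  have f_coeff (k : Fin d → ℤ) :
      ∫ x, mFourier (-k) (fun i ↦ (x i : UnitAddCircle)) * f x =
        s ^ (-(d : ℂ) / 2) * ((|A.det| : ℝ)⁻¹ : ℂ) *
          Complex.exp (-(Real.pi : ℂ) *
              ((∑ j, ((Aᵀ)⁻¹ *ᵥ (fun i ↦ (k i : ℝ))) j ^ 2 : ℝ) : ℂ) * s⁻¹
            + 2 * (Real.pi : ℂ) * Complex.I *
              ∑ j, (((Aᵀ)⁻¹ *ᵥ (fun i ↦ (k i : ℝ))) j : ℂ) * w j) := by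
    set p := (Aᵀ)⁻¹ *ᵥ (fun i ↦ (k i : ℝ)) with hp
    have h_char (x : Fin d → ℝ) : mFourier (-k) (fun i ↦ (x i : UnitAddCircle)) =
        Complex.exp (-(2 * Real.pi * Complex.I * ∑ j, (p j : ℂ) * (A *ᵥ x) j)) := by
      have := sum_mul_eq_sum_inv_transpose_mulVec_mul_mulVec hA (fun i ↦ (k i : ℝ)) x
      rw [← hp] at this
      rw [mFourier_coe_apply, ← mul_neg]
      congr 2
      rw [← Complex.ofReal_inj] at this
      push_cast at this
      simp [← this]
    have := integral_comp_mulVec hA.ne_zero (g := fun y ↦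
      Complex.exp (-(2 * Real.pi * Complex.I * ∑ j, (p j : ℂ) * y j)) *
        Complex.exp (-Real.pi * s * ∑ j, ((y j : ℂ) + w j) ^ 2)) (by fun_prop)
    rw [integral_cexp_neg_pi_mul_sum_sq_add hs, Fintype.card_fin, Complex.real_smul,
      Complex.ofReal_inv] at this
    simp_rw [h_char]
    refine this.trans ?_
    ring
  have f_sum : Summable fun k : Fin d → ℤ ↦
      ∫ x, mFourier (-k) (fun i ↦ (x i : UnitAddCircle)) * f x := by
    simp_rw [f_coeff]
    obtain ⟨C', c', -, hc', hf'⟩ := exists_norm_cexp_quadratic_mulVec_le hA' hπs'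
      fun j ↦ 2 * Real.pi * Complex.I * w j
    refine Summable.mul_left _ ?_
    refine Summable.of_norm_bounded ((summable_prod_exp_neg_mul_int_sq hc').mul_left C') fun k ↦ ?_
    refine (le_of_eq (congrArg (‖Complex.exp ·‖) ?_)).trans (hf' fun i ↦ (k i : ℝ))
    push_cast
    rw [Finset.mul_sum _ _ (2 * (Real.pi : ℂ) * Complex.I)]
    refine congrArg₂ (· + ·) (by ring) (Finset.sum_congr rfl fun j _ ↦ by ring)
  rw [← tsum_mul_left]
  refine (tsum_eq_tsum_integral_mFourier f_int f_norm f_sum).trans ?_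
  exact tsum_congr f_coeff
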